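/- arXiv:2310.00663 — 2 statements merged into one kernel-verified Lean document; each statement's English description precedes it below -/
import Mathlib

section
/- Let S be a countably based, left-soft separative, (2,ω)-divisible Cu-semigroup satisfying (O5), (O6) and (O7), and let σ: S → S be the map sending x to the supremum of L_x (the largest strongly soft element below x). Then σ preserves order (x ≤ y implies σ(x) ≤ σ(y)), preserves suprema of increasing sequences, and is superadditive (σ(x)+σ(y) ≤ σ(x+y)). Moreover, 2σ(x+y) = σ(x+y) + (σ(x)+σ(y)) = 2(σ(x)+σ(y)) for all x,y ∈ S. -/
open Set

/-- The way-below relation: `x ≪ y` if for every increasing sequence with a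
supremum dominating `y`, some term of the sequence dominates `x`. -/
def WayBelow {S : Type*} [Preorder S] (x y : S) : Prop :=
  ∀ z : ℕ → S, Monotone z → ∀ s : S, IsLUB (Set.range z) s → y ≤ s → ∃ m : ℕ, x ≤ z m

/-- A Cu-semigroup: a positively ordered commutative monoid satisfying (O1)-(O4). -/
class CuSemigroup (S : Type*) extends AddCommMonoid S, PartialOrder S where
  zero_le : ∀ x : S, 0 ≤ x
  add_mono : ∀ {a b c d : S}, a ≤ b → c ≤ d → a + c ≤ b + d
  O1 : ∀ z : ℕ → S, Monotone z → ∃ s : S, IsLUB (Set.range z) s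
  O2 : ∀ x : S, ∃ z : ℕ → S, (∀ n, WayBelow (z n) (z (n + 1))) ∧ IsLUB (Set.range z) x
  O3 : ∀ {x' x y' y : S}, WayBelow x' x → WayBelow y' y → WayBelow (x' + y') (x + y)
  O4 : ∀ (x y : ℕ → S), Monotone x → Monotone y → ∀ sx sy : S,
      IsLUB (Set.range x) sx → IsLUB (Set.range y) sy →
      IsLUB (Set.range fun n => x n + y n) (sx + sy)

variable {S : Type*}

lemma CuSemigroup.nsmul_mono [CuSemigroup S] (x : S) : Monotone fun n : ℕ => n • x := by
  intro n m h
  obtain ⟨k, rfl⟩ := Nat.exists_eq_add_of_le h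
  show n • x ≤ (n + k) • x
  rw [add_nsmul]
  calc n • x = n • x + 0 := by rw [add_zero]
    _ ≤ n • x + k • x := CuSemigroup.add_mono le_rfl (CuSemigroup.zero_le _)

/-- `infty x` is the supremum of the increasing sequence `n • x`, i.e. `∞x`. -/
noncomputable def infty [CuSemigroup S] (x : S) : S :=
  (CuSemigroup.O1 (fun n : ℕ => n • x) (CuSemigroup.nsmul_mono x)).choose

lemma infty_isLUB [CuSemigroup S] (x : S) :
    IsLUB (Set.range fun n : ℕ => n • x) (infty x) :=
  (CuSemigroup.O1 (fun n : ℕ => n • x) (CuSemigroup.nsmul_mono x)).choose_spec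

/-- An element is strongly soft if every `x' ≪ x` admits `t` with `x' + t ≪ x`
and `x' ≪ ∞t`. -/
def StronglySoft [CuSemigroup S] (x : S) : Prop :=
  ∀ x' : S, WayBelow x' x → ∃ t : S, WayBelow (x' + t) x ∧ WayBelow x' (infty t)

def SatisfiesO5 (S : Type*) [CuSemigroup S] : Prop :=
  ∀ x' x y' y z : S, WayBelow x' x → WayBelow y' y → x + y ≤ z →
    ∃ c : S, WayBelow y' c ∧ x' + c ≤ z ∧ z ≤ x + c

def SatisfiesO6 (S : Type*) [CuSemigroup S] : Prop :=
  ∀ x' x y z : S, WayBelow x' x → WayBelow x (y + z) →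
    ∃ v w : S, v ≤ x ∧ v ≤ y ∧ w ≤ x ∧ w ≤ z ∧ x' ≤ v + w

def SatisfiesO7 (S : Type*) [CuSemigroup S] : Prop :=
  ∀ x' x y' y w : S, WayBelow x' x → x ≤ w → WayBelow y' y → y ≤ w →
    ∃ z : S, WayBelow x' z ∧ WayBelow y' z ∧ z ≤ w ∧ z ≤ x + y

def TwoOmegaDivisible (S : Type*) [CuSemigroup S] : Prop :=
  ∀ x' x : S, WayBelow x' x → ∃ y : S, 2 • y ≤ x ∧ x' ≤ infty y

def WeaklyCancellative (S : Type*) [CuSemigroup S] : Prop :=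
  ∀ x y z : S, WayBelow (x + z) (y + z) → WayBelow x y

def Separative (S : Type*) [CuSemigroup S] : Prop :=
  ∀ x y t : S, WayBelow (x + t) (y + t) → WayBelow t (infty x) → WayBelow t (infty y) →
    WayBelow x y

def LeftSoftSeparative (S : Type*) [CuSemigroup S] : Prop :=
  ∀ x y t : S, StronglySoft x → WayBelow (x + t) (y + t) → WayBelow t (infty x) →
    WayBelow t (infty y) → WayBelow x y

def AlmostUnperforated (S : Type*) [CuSemigroup S] : Prop :=
  ∀ x y : S, (∃ n : ℕ, 1 ≤ n ∧ (n + 1) • x ≤ n • y) → x ≤ y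

def CountablyBased (S : Type*) [CuSemigroup S] : Prop :=
  ∃ D : Set S, D.Countable ∧
    ∀ x : S, ∃ z : ℕ → S, Monotone z ∧ (∀ n, z n ∈ D) ∧ IsLUB (Set.range z) x

/-- `Lset x` is the set `L_x = { u' : u' ≪ u ≪ x for some strongly soft u }`. -/
def Lset [CuSemigroup S] (x : S) : Set S :=
  { u' | ∃ u : S, StronglySoft u ∧ WayBelow u' u ∧ WayBelow u x }

/-- A functional on a Cu-semigroup: a monoid morphism to `[0,∞]` preserving order
and suprema of increasing sequences. -/
structure CuFunctional (S : Type*) [CuSemigroup S] where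
  toFun : S → ENNReal
  map_zero : toFun 0 = 0
  map_add : ∀ x y : S, toFun (x + y) = toFun x + toFun y
  mono : ∀ x y : S, x ≤ y → toFun x ≤ toFun y
  map_sup : ∀ z : ℕ → S, Monotone z → ∀ s : S, IsLUB (Set.range z) s →
    toFun s = ⨆ n, toFun (z n)

/-- Predicate version: `f : S → [0,∞]` is a functional on `S`. -/
def IsCuFunctional [CuSemigroup S] (f : S → ENNReal) : Prop :=
  f 0 = 0 ∧ (∀ x y : S, f (x + y) = f x + f y) ∧ (∀ x y : S, x ≤ y → f x ≤ f y) ∧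
  (∀ z : ℕ → S, Monotone z → ∀ s : S, IsLUB (Set.range z) s → f s = ⨆ n, f (z n))

/-- Least upper bound of `A` computed within the subset `T`. -/
def IsLUBIn [CuSemigroup S] (T : Set S) (A : Set S) (s : S) : Prop :=
  s ∈ T ∧ s ∈ upperBounds A ∧ ∀ b ∈ T, b ∈ upperBounds A → s ≤ b

/-- The way-below relation computed within the subset `T`. -/
def WayBelowIn [CuSemigroup S] (T : Set S) (x y : S) : Prop :=
  ∀ z : ℕ → S, Monotone z → (∀ n, z n ∈ T) → ∀ s : S, IsLUBIn T (Set.range z) s → y ≤ s →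
    ∃ m : ℕ, x ≤ z m

/-- `T` is a sub-Cu-semigroup of `S`: a submonoid which is itself a Cu-semigroup
for the inherited order, such that the inclusion preserves suprema of increasing
sequences and the way-below relation. -/
structure IsSubCuSemigroup [CuSemigroup S] (T : Set S) : Prop where
  zero_mem : (0 : S) ∈ T
  add_mem : ∀ {x y : S}, x ∈ T → y ∈ T → x + y ∈ T
  o1 : ∀ z : ℕ → S, Monotone z → (∀ n, z n ∈ T) → ∃ s : S, IsLUBIn T (Set.range z) s
  o2 : ∀ x ∈ T, ∃ z : ℕ → S, (∀ n, z n ∈ T) ∧ (∀ n, WayBelowIn T (z n) (z (n + 1))) ∧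
        IsLUBIn T (Set.range z) x
  o3 : ∀ {x' x y' y : S}, x' ∈ T → x ∈ T → y' ∈ T → y ∈ T →
        WayBelowIn T x' x → WayBelowIn T y' y → WayBelowIn T (x' + y') (x + y)
  o4 : ∀ (x y : ℕ → S), Monotone x → Monotone y → (∀ n, x n ∈ T) → (∀ n, y n ∈ T) →
        ∀ sx sy : S, IsLUBIn T (Set.range x) sx → IsLUBIn T (Set.range y) sy →
        IsLUBIn T (Set.range fun n => x n + y n) (sx + sy)
  incl_sup : ∀ z : ℕ → S, Monotone z → (∀ n, z n ∈ T) → ∀ s : S,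
        IsLUBIn T (Set.range z) s → IsLUB (Set.range z) s
  incl_wayBelow : ∀ {x y : S}, x ∈ T → y ∈ T → WayBelowIn T x y → WayBelow x y

def SatisfiesO5In [CuSemigroup S] (T : Set S) : Prop :=
  ∀ x' x y' y z : S, x' ∈ T → x ∈ T → y' ∈ T → y ∈ T → z ∈ T →
    WayBelowIn T x' x → WayBelowIn T y' y → x + y ≤ z →
    ∃ c ∈ T, WayBelowIn T y' c ∧ x' + c ≤ z ∧ z ≤ x + c

def SatisfiesO6In [CuSemigroup S] (T : Set S) : Prop :=
  ∀ x' x y z : S, x' ∈ T → x ∈ T → y ∈ T → z ∈ T →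
    WayBelowIn T x' x → WayBelowIn T x (y + z) →
    ∃ v ∈ T, ∃ w ∈ T, v ≤ x ∧ v ≤ y ∧ w ≤ x ∧ w ≤ z ∧ x' ≤ v + w

def SatisfiesO7In [CuSemigroup S] (T : Set S) : Prop :=
  ∀ x' x y' y w : S, x' ∈ T → x ∈ T → y' ∈ T → y ∈ T → w ∈ T →
    WayBelowIn T x' x → x ≤ w → WayBelowIn T y' y → y ≤ w →
    ∃ z ∈ T, WayBelowIn T x' z ∧ WayBelowIn T y' z ∧ z ≤ w ∧ z ≤ x + y

/-- `f` is a functional on the sub-Cu-semigroup `T` (values off `T` are irrelevant). -/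
def IsFunctionalOn [CuSemigroup S] (T : Set S) (f : S → ENNReal) : Prop :=
  f 0 = 0 ∧
  (∀ x ∈ T, ∀ y ∈ T, f (x + y) = f x + f y) ∧
  (∀ x ∈ T, ∀ y ∈ T, x ≤ y → f x ≤ f y) ∧
  (∀ z : ℕ → S, Monotone z → (∀ n, z n ∈ T) → ∀ s : S, IsLUBIn T (Set.range z) s →
    f s = ⨆ n, f (z n))

/-- An element is full if `x ≤ ∞e` for every `x`. -/
def IsFull [CuSemigroup S] (e : S) : Prop := ∀ x : S, x ≤ infty e

/-- Condition (R1) for `r`: comparison of `x` with `y` whenever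
`λ(x) + r·λ(e) ≤ λ(y)` for all functionals. -/
def SatisfiesR1 (S : Type*) [CuSemigroup S] (e : S) (r : NNReal) : Prop :=
  ∀ x y : S,
    (∀ lam : CuFunctional S, lam.toFun x + (r : ENNReal) * lam.toFun e ≤ lam.toFun y) → x ≤ y

/-- The radius of comparison of `(S, e)`. -/
noncomputable def rc (S : Type*) [CuSemigroup S] (e : S) : ENNReal :=
  ⨅ r ∈ {r : NNReal | 0 < r ∧ SatisfiesR1 S e r}, (r : ENNReal)

/-- Condition (R1) for the sub-Cu-semigroup `T`. -/
def SatisfiesR1On [CuSemigroup S] (T : Set S) (e : S) (r : NNReal) : Prop :=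
  ∀ x ∈ T, ∀ y ∈ T,
    (∀ f : S → ENNReal, IsFunctionalOn T f → f x + (r : ENNReal) * f e ≤ f y) → x ≤ y

/-- The radius of comparison of `(T, e)` for a sub-Cu-semigroup `T ⊆ S`. -/
noncomputable def rcOn [CuSemigroup S] (T : Set S) (e : S) : ENNReal :=
  ⨅ r ∈ {r : NNReal | 0 < r ∧ SatisfiesR1On T e r}, (r : ENNReal)

/-- `dim S ≤ n` in the sense of covering dimension of Cu-semigroups. -/
def DimLe (S : Type*) [CuSemigroup S] (n : ℕ) : Prop :=
  ∀ (x' x : S) (r : ℕ) (y : Fin r → S), WayBelow x' x → WayBelow x (∑ j, y j) →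
    ∃ z : Fin r → Fin (n + 1) → S,
      (∀ j k, WayBelow (z j k) (y j)) ∧
      WayBelow x' (∑ j, ∑ k, z j k) ∧
      (∀ k, WayBelow (∑ j, z j k) x)

/-- The covering dimension of a Cu-semigroup, in `ℕ ∪ {∞}`. -/
noncomputable def cuDim (S : Type*) [CuSemigroup S] : ℕ∞ :=
  ⨅ n ∈ {n : ℕ | DimLe S n}, (n : ℕ∞)

/-- `dim T ≤ n` for a sub-Cu-semigroup `T ⊆ S`. -/
def DimLeOn [CuSemigroup S] (T : Set S) (n : ℕ) : Prop :=
  ∀ (x' x : S), x' ∈ T → x ∈ T → ∀ (r : ℕ) (y : Fin r → S), (∀ j, y j ∈ T) →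
    WayBelowIn T x' x → WayBelowIn T x (∑ j, y j) →
    ∃ z : Fin r → Fin (n + 1) → S,
      (∀ j k, z j k ∈ T) ∧
      (∀ j k, WayBelowIn T (z j k) (y j)) ∧
      WayBelowIn T x' (∑ j, ∑ k, z j k) ∧
      (∀ k, WayBelowIn T (∑ j, z j k) x)

/-- The covering dimension of a sub-Cu-semigroup `T ⊆ S`. -/
noncomputable def cuDimOn [CuSemigroup S] (T : Set S) : ℕ∞ :=
  ⨅ n ∈ {n : ℕ | DimLeOn T n}, (n : ℕ∞)

instance CuSemigroup.toIsOrderedAddMonoid [CuSemigroup S] : IsOrderedAddMonoid S where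
  add_le_add_left _ _ h _ := CuSemigroup.add_mono h le_rfl

namespace CuSemigroup

variable [CuSemigroup S] {a b c x x' y y' z t u v w : S}

lemma le_add_right' (x y : S) : x ≤ x + y := by
  simpa using add_le_add_right (zero_le y) x

lemma le_add_left' (x y : S) : x ≤ y + x := by
  simpa using add_le_add_left (zero_le y) x

end CuSemigroup

namespace WayBelow

variable [CuSemigroup S] {a b x x' y y' z : S}

lemma le (h : WayBelow x y) : x ≤ y := by
  obtain ⟨_, hm⟩ := h (fun _ => y) monotone_const y (by simp) le_rfl
  exact hm

lemma trans_le (h : WayBelow x y) (hyz : y ≤ z) : WayBelow x z :=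
  fun f hf s hs hzs => h f hf s hs (hyz.trans hzs)

lemma of_le (hxy : x ≤ y) (h : WayBelow y z) : WayBelow x z := by
  intro f hf s hs hzs
  obtain ⟨m, hm⟩ := h f hf s hs hzs
  exact ⟨m, hxy.trans hm⟩

lemma trans (h : WayBelow x y) (h' : WayBelow y z) : WayBelow x z := h.trans_le h'.le

lemma zero (x : S) : WayBelow 0 x := fun _ _ _ _ _ => ⟨0, CuSemigroup.zero_le _⟩

lemma exists_isLUB (x : S) : ∃ z : ℕ → S, Monotone z ∧ (∀ n, WayBelow (z n) x) ∧
    IsLUB (Set.range z) x := by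
  obtain ⟨z, hz, hlub⟩ := CuSemigroup.O2 x
  exact ⟨z, monotone_nat_of_le_succ fun n => (hz n).le,
    fun n => (hz n).trans_le (hlub.1 ⟨n + 1, rfl⟩), hlub⟩

lemma exists_common (ha : WayBelow a x) (hb : WayBelow b x) :
    ∃ m, WayBelow a m ∧ WayBelow b m ∧ WayBelow m x := by
  obtain ⟨z, hz, hlub⟩ := CuSemigroup.O2 x
  have hmono : Monotone z := monotone_nat_of_le_succ fun n => (hz n).le
  obtain ⟨i, hi⟩ := ha z hmono x hlub le_rfl
  obtain ⟨j, hj⟩ := hb z hmono x hlub le_rfl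
  refine ⟨z (max i j + 1), of_le (hi.trans (hmono (le_max_left i j))) (hz _),
    of_le (hj.trans (hmono (le_max_right i j))) (hz _),
    (hz _).trans_le (hlub.1 ⟨max i j + 1 + 1, rfl⟩)⟩

lemma exists_between (h : WayBelow x y) : ∃ m, WayBelow x m ∧ WayBelow m y := by
  obtain ⟨m, h1, -, h2⟩ := exists_common h h
  exact ⟨m, h1, h2⟩

lemma exists_add (h : WayBelow z (x + y)) :
    ∃ x' y', WayBelow x' x ∧ WayBelow y' y ∧ z ≤ x' + y' := by
  obtain ⟨f, hf, hfx, hlf⟩ := exists_isLUB x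
  obtain ⟨g, hg, hgy, hlg⟩ := exists_isLUB y
  obtain ⟨m, hm⟩ := h _ (hf.add hg) _ (CuSemigroup.O4 f g hf hg x y hlf hlg) le_rfl
  exact ⟨f m, g m, hfx m, hgy m, hm⟩

lemma exists_nsmul {n : ℕ} (h : WayBelow z (n • x)) : ∃ x', WayBelow x' x ∧ z ≤ n • x' := by
  induction n generalizing z with
  | zero => exact ⟨0, zero x, by simpa using h.le⟩
  | succ n ih =>
    rw [succ_nsmul] at h
    obtain ⟨p, q, hp, hq, hz⟩ := exists_add h
    obtain ⟨x₁, hx₁, hp₁⟩ := ih hp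
    obtain ⟨m, hm₁, hm₂, hm⟩ := exists_common hx₁ hq
    refine ⟨m, hm, hz.trans ?_⟩
    rw [succ_nsmul]
    exact add_le_add (hp₁.trans (nsmul_le_nsmul_right hm₁.le n)) hm₂.le

lemma exists_le_nsmul (h : WayBelow z (infty x)) : ∃ n : ℕ, z ≤ n • x :=
  h _ (CuSemigroup.nsmul_mono x) _ (infty_isLUB x) le_rfl

end WayBelow

lemma le_of_forall_wayBelow_le [CuSemigroup S] {x y : S} (h : ∀ x', WayBelow x' x → x' ≤ y) :
    x ≤ y := by
  obtain ⟨f, -, hfx, hlf⟩ := WayBelow.exists_isLUB x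
  exact hlf.2 (by rintro _ ⟨n, rfl⟩; exact h _ (hfx n))

lemma add_le_of_forall_wayBelow_le [CuSemigroup S] {x y z : S}
    (h : ∀ x' y', WayBelow x' x → WayBelow y' y → x' + y' ≤ z) : x + y ≤ z := by
  refine le_of_forall_wayBelow_le fun p hp => ?_
  obtain ⟨x', y', hx, hy, hle⟩ := hp.exists_add
  exact hle.trans (h _ _ hx hy)

section Infty

variable [CuSemigroup S] {a b c x y z : S}

lemma nsmul_le_infty (n : ℕ) (x : S) : n • x ≤ infty x := (infty_isLUB x).1 ⟨n, rfl⟩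

lemma le_infty (x : S) : x ≤ infty x := by simpa using nsmul_le_infty 1 x

lemma infty_add_infty_le (x : S) : infty x + infty x ≤ infty x := by
  refine (CuSemigroup.O4 _ _ (CuSemigroup.nsmul_mono x) (CuSemigroup.nsmul_mono x) _ _
    (infty_isLUB x) (infty_isLUB x)).2 ?_
  rintro _ ⟨n, rfl⟩
  show n • x + n • x ≤ infty x
  rw [← add_nsmul]
  exact nsmul_le_infty _ _

lemma add_le_infty (ha : a ≤ infty c) (hb : b ≤ infty c) : a + b ≤ infty c :=
  (add_le_add ha hb).trans (infty_add_infty_le c)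

lemma nsmul_le_infty_of_le (ha : a ≤ infty c) (n : ℕ) : n • a ≤ infty c := by
  induction n with
  | zero => simpa using CuSemigroup.zero_le _
  | succ n ih => rw [succ_nsmul]; exact add_le_infty ih ha

lemma infty_le_infty (h : a ≤ infty b) : infty a ≤ infty b :=
  (infty_isLUB a).2 (by rintro _ ⟨n, rfl⟩; exact nsmul_le_infty_of_le h n)

lemma infty_mono (h : a ≤ b) : infty a ≤ infty b := infty_le_infty (h.trans (le_infty b))

lemma WayBelow.add_infty (ha : WayBelow a (infty c)) (hb : WayBelow b (infty c)) :
    WayBelow (a + b) (infty c) :=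
  (CuSemigroup.O3 ha hb).trans_le (infty_add_infty_le c)

lemma WayBelow.exists_infty (h : WayBelow z (infty x)) :
    ∃ x', WayBelow x' x ∧ WayBelow z (infty x') := by
  obtain ⟨m, hzm, hm⟩ := h.exists_between
  obtain ⟨m', hzm', hm'⟩ := hzm.exists_between
  obtain ⟨n, hn⟩ := hm.exists_le_nsmul
  obtain ⟨x', hx', hle⟩ := (hm'.trans_le hn).exists_nsmul
  exact ⟨x', hx', hzm'.trans_le (hle.trans (nsmul_le_infty n x'))⟩

end Infty

section StronglySoft

variable [CuSemigroup S] {b u u' v x : S}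

lemma StronglySoft.of_le (h : ∀ x', WayBelow x' x → ∃ t, x' + t ≤ x ∧ x' ≤ infty t) :
    StronglySoft x := by
  intro x' hx'
  obtain ⟨x₁, hx₁, hx₁x⟩ := hx'.exists_between
  obtain ⟨t, hle, hinf⟩ := h x₁ hx₁x
  obtain ⟨t', ht', hinf'⟩ := (hx₁.trans_le hinf).exists_infty
  exact ⟨t', (CuSemigroup.O3 hx₁ ht').trans_le hle, hinf'⟩

lemma stronglySoft_zero : StronglySoft (0 : S) :=
  .of_le fun x' hx' => ⟨0, by simpa using hx'.le, hx'.le.trans (CuSemigroup.zero_le _)⟩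

lemma StronglySoft.add (hu : StronglySoft u) (hv : StronglySoft v) : StronglySoft (u + v) := by
  refine .of_le fun x' hx' => ?_
  obtain ⟨p, q, hp, hq, hle⟩ := hx'.exists_add
  obtain ⟨s, hs, hps⟩ := hu p hp
  obtain ⟨t, ht, hqt⟩ := hv q hq
  refine ⟨s + t, ?_, hle.trans (add_le_infty
    (hps.le.trans (infty_mono (CuSemigroup.le_add_right' s t)))
    (hqt.le.trans (infty_mono (CuSemigroup.le_add_left' t s))))⟩
  calc x' + (s + t) ≤ p + q + (s + t) := by gcongr
    _ = (p + s) + (q + t) := by abel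
    _ ≤ u + v := add_le_add hs.le ht.le

lemma StronglySoft.add_of_le_infty (hv : StronglySoft v) (hb : b ≤ infty v) :
    StronglySoft (v + b) := by
  refine .of_le fun x' hx' => ?_
  obtain ⟨p, q, hp, hq, hle⟩ := hx'.exists_add
  obtain ⟨p', hp', hqp'⟩ := (hq.trans_le hb).exists_infty
  obtain ⟨m, hpm, hpm', hm⟩ := hp.exists_common hp'
  obtain ⟨t, ht, hmt⟩ := hv m hm
  refine ⟨t, ?_, hle.trans (add_le_infty (hpm.le.trans hmt.le)
    (hqp'.le.trans (infty_le_infty (hpm'.le.trans hmt.le))))⟩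
  calc x' + t ≤ m + q + t := by
        have := hle.trans (add_le_add_left hpm.le q)
        gcongr
    _ = (m + t) + q := by abel
    _ ≤ v + b := add_le_add ht.le hq.le

lemma exists_pow_nsmul_le (hdiv : TwoOmegaDivisible S) (k : ℕ) {a' a : S} (h : WayBelow a' a) :
    ∃ y, 2 ^ k • y ≤ a ∧ a' ≤ infty y := by
  induction k generalizing a' with
  | zero => exact ⟨a, by simp, h.le.trans (le_infty a)⟩
  | succ k ih =>
    obtain ⟨m, hm, hma⟩ := h.exists_between
    obtain ⟨y, hy, hmy⟩ := ih hma
    obtain ⟨y', hy', hay'⟩ := (hm.trans_le hmy).exists_infty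
    obtain ⟨y₂, hy₂, hle⟩ := hdiv y' y hy'
    refine ⟨y₂, ?_, hay'.le.trans (infty_le_infty hle)⟩
    rw [pow_succ, mul_nsmul']
    exact (nsmul_le_nsmul_right hy₂ _).trans hy

lemma exists_nsmul_le (hdiv : TwoOmegaDivisible S) (n : ℕ) {a' a : S} (h : WayBelow a' a) :
    ∃ y, n • y ≤ a ∧ a' ≤ infty y := by
  obtain ⟨y, hy, hle⟩ := exists_pow_nsmul_le hdiv n h
  exact ⟨y, (CuSemigroup.nsmul_mono y Nat.lt_two_pow_self.le).trans hy, hle⟩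

lemma exists_half_pair (hdiv : TwoOmegaDivisible S) {b y : S} (h : WayBelow b y) :
    ∃ b' y', WayBelow b' y' ∧ 2 • y' ≤ y ∧ b ≤ infty b' := by
  obtain ⟨m, hbm, hm⟩ := h.exists_between
  obtain ⟨y', hy', hle⟩ := hdiv m y hm
  obtain ⟨b', hb', hbb'⟩ := (hbm.trans_le hle).exists_infty
  exact ⟨b', y', hb', hy', hbb'.le⟩

/-- Every `a' ≪ a` lies in the ideal generated by some strongly soft element below `a`. -/
lemma exists_stronglySoft_le (hdiv : TwoOmegaDivisible S) {a' a : S} (h : WayBelow a' a) :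
    ∃ v, StronglySoft v ∧ v ≤ a ∧ a' ≤ infty v := by
  have step : ∀ p : {p : S × S // WayBelow p.1 p.2}, ∃ q : {p : S × S // WayBelow p.1 p.2},
      2 • q.1.2 ≤ p.1.2 ∧ p.1.1 ≤ infty q.1.1 := by
    rintro ⟨⟨b, y⟩, hby⟩
    obtain ⟨b', y', h₁, h₂, h₃⟩ := exists_half_pair hdiv hby
    exact ⟨⟨(b', y'), h₁⟩, h₂, h₃⟩
  choose f hf₁ hf₂ using step
  let p : ℕ → {p : S × S // WayBelow p.1 p.2} := fun n => f^[n] ⟨(a', a), h⟩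
  have hp : ∀ n, p (n + 1) = f (p n) := fun n => Function.iterate_succ_apply' f n _
  let s : ℕ → S := fun n => ∑ i ∈ Finset.range n, (p (i + 1)).1.1
  have hs : ∀ n, s (n + 1) = s n + (p (n + 1)).1.1 := fun n => Finset.sum_range_succ _ n
  have hmono : Monotone s := monotone_nat_of_le_succ fun n => by
    rw [hs]; exact CuSemigroup.le_add_right' _ _
  have hgen : ∀ n, (p n).1.1 ≤ infty (p (n + 1)).1.1 := fun n => by rw [hp]; exact hf₂ _
  have hle : ∀ n, s n + (p n).1.2 ≤ a := by
    intro n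
    induction n with
    | zero => simp [s, p]
    | succ n ih =>
      refine le_trans ?_ ih
      rw [hs, add_assoc]
      gcongr
      calc (p (n + 1)).1.1 + (p (n + 1)).1.2 ≤ (p (n + 1)).1.2 + (p (n + 1)).1.2 := by
            have := (p (n + 1)).2.le
            gcongr
        _ = 2 • (p (n + 1)).1.2 := (two_nsmul _).symm
        _ ≤ (p n).1.2 := by rw [hp]; exact hf₁ _
  have hsgen : ∀ n, s n ≤ infty (p (n + 1)).1.1 := by
    intro n
    induction n with
    | zero => simpa [s] using CuSemigroup.zero_le _
    | succ n ih =>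
      rw [hs]
      exact add_le_infty (ih.trans (infty_le_infty (hgen _))) (hgen _)
  obtain ⟨v, hv⟩ := CuSemigroup.O1 s hmono
  refine ⟨v, .of_le fun x' hx' => ?_, hv.2 ?_, ?_⟩
  · obtain ⟨n, hn⟩ := hx' s hmono v hv le_rfl
    refine ⟨(p (n + 1)).1.1, ?_, hn.trans (hsgen n)⟩
    calc x' + (p (n + 1)).1.1 ≤ s n + (p (n + 1)).1.1 := by gcongr
      _ = s (n + 1) := (hs n).symm
      _ ≤ v := hv.1 ⟨n + 1, rfl⟩
  · rintro _ ⟨n, rfl⟩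
    exact (CuSemigroup.le_add_right' _ _).trans (hle n)
  · refine (hgen 0).trans (infty_mono ?_)
    calc (p 1).1.1 = s 1 := by simp [s]
      _ ≤ v := hv.1 ⟨1, rfl⟩

lemma exists_stronglySoft_wayBelow_infty (hdiv : TwoOmegaDivisible S) {p a : S}
    (h : WayBelow p (infty a)) : ∃ v, StronglySoft v ∧ v ≤ a ∧ WayBelow p (infty v) := by
  obtain ⟨a', ha', hp⟩ := h.exists_infty
  obtain ⟨v, hv, hva, hle⟩ := exists_stronglySoft_le hdiv ha'
  exact ⟨v, hv, hva, hp.trans_le (infty_le_infty hle)⟩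

lemma StronglySoft.exists_between (hdiv : TwoOmegaDivisible S) (hu : StronglySoft u)
    (h : WayBelow u' u) : ∃ e, StronglySoft e ∧ WayBelow u' e ∧ WayBelow e u := by
  obtain ⟨m, hm, hmu⟩ := WayBelow.exists_between h
  obtain ⟨t, ht, hmt⟩ := hu m hmu
  obtain ⟨v, hv, hvt, hmv⟩ := exists_stronglySoft_wayBelow_infty hdiv hmt
  refine ⟨v + m, hv.add_of_le_infty hmv.le, hm.trans_le (CuSemigroup.le_add_left' _ _), .of_le ?_ ht⟩
  rw [add_comm]
  gcongr

end StronglySoft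

section IdealIntersection

variable [CuSemigroup S]

lemma exists_le_le_nsmul (hO6 : SatisfiesO6 S) (hO7 : SatisfiesO7 S) {z : S} (n : ℕ) {x' x : S}
    (h : WayBelow x' x) (hx : x ≤ n • z) : ∃ u, u ≤ z ∧ u ≤ n • x ∧ x' ≤ n • u := by
  induction n generalizing x' x with
  | zero =>
    exact ⟨0, CuSemigroup.zero_le _, by simp, by simpa using h.le.trans hx⟩
  | succ n ih =>
    obtain ⟨x₂, hx'₂, hx₂⟩ := h.exists_between
    obtain ⟨x₃, hx₂₃, hx₃⟩ := hx₂.exists_between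
    rw [succ_nsmul] at hx
    obtain ⟨v, w, hvx, hvz, hwx, hwz, hle⟩ := hO6 x₂ x₃ _ _ hx₂₃ (hx₃.trans_le hx)
    obtain ⟨v', w', hv', hw', hle'⟩ := (hx'₂.trans_le hle).exists_add
    obtain ⟨v₁, hv'₁, hv₁⟩ := hv'.exists_between
    obtain ⟨u₁, hu₁z, hu₁v, hv₁u⟩ := ih hv₁ hvz
    obtain ⟨u', hu', hvu'⟩ := (hv'₁.trans_le hv₁u).exists_nsmul
    obtain ⟨u, hu'u, hw'u, huz, hu⟩ := hO7 u' u₁ w' w z hu' hu₁z hw' hwz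
    refine ⟨u, huz, ?_, ?_⟩
    · rw [succ_nsmul]
      have hv := nsmul_le_nsmul_right (hvx.trans hx₃.le) n
      exact hu.trans (add_le_add (hu₁v.trans hv) (hwx.trans hx₃.le))
    · rw [succ_nsmul]
      exact hle'.trans (add_le_add (hvu'.trans (nsmul_le_nsmul_right hu'u.le n)) hw'u.le)

/-- If `x` lies in the ideal generated by `z`, then every `x' ≪ x` lies in the ideal generated
by some element below both `x` and `z`. -/
lemma exists_le_le_infty (hdiv : TwoOmegaDivisible S) (hO6 : SatisfiesO6 S)
    (hO7 : SatisfiesO7 S) {x' x z : S} (h : WayBelow x' x) (hx : x ≤ infty z) :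
    ∃ u, u ≤ x ∧ u ≤ z ∧ x' ≤ infty u := by
  obtain ⟨x₁, hx'₁, hx₁⟩ := h.exists_between
  obtain ⟨x₂, hx₁₂, hx₂⟩ := hx₁.exists_between
  obtain ⟨n, hn⟩ := (hx₂.trans_le hx).exists_le_nsmul
  obtain ⟨y, hy, hle⟩ := exists_nsmul_le hdiv (n + 1) hx₁₂
  obtain ⟨y', hy', hxy'⟩ := (hx'₁.trans_le hle).exists_infty
  have hyn : n • y ≤ x₂ := (CuSemigroup.nsmul_mono y n.le_succ).trans hy
  have hyx : y ≤ n • z := by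
    refine le_trans ?_ (hy.trans hn)
    rw [succ_nsmul]
    exact CuSemigroup.le_add_left' _ _
  obtain ⟨u, huz, huy, hyu⟩ := exists_le_le_nsmul hO6 hO7 n hy' hyx
  exact ⟨u, huy.trans (hyn.trans hx₂.le), huz,
    hxy'.le.trans (infty_le_infty (hyu.trans (nsmul_le_infty n u)))⟩

end IdealIntersection

section Directed

variable [CuSemigroup S]

/-- A strongly soft element below `x` can be enlarged to a strongly soft element below `x`
generating the ideal of a prescribed `x₁ ≪ x`. -/
lemma StronglySoft.exists_ge_full (hdiv : TwoOmegaDivisible S) (hO5 : SatisfiesO5 S)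
    {u' u x₁ x : S} (hu : StronglySoft u) (hu' : WayBelow u' u) (hux : u ≤ x₁)
    (hx₁ : WayBelow x₁ x) :
    ∃ e, StronglySoft e ∧ u' ≤ e ∧ e ≤ x ∧ x₁ ≤ infty e := by
  obtain ⟨m, hu'm, hm⟩ := hu'.exists_between
  obtain ⟨t, ht, hmt⟩ := hu m hm
  obtain ⟨t', ht', hmt'⟩ := hmt.exists_infty
  obtain ⟨c, htc, hle, hge⟩ := hO5 u' m t' t x hu'm ht' (ht.le.trans (hux.trans hx₁.le))
  have hxc : x ≤ infty c :=
    hge.trans (add_le_infty (hmt'.le.trans (infty_mono htc.le)) (le_infty c))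
  obtain ⟨v, hv, hvc, hxv⟩ := exists_stronglySoft_wayBelow_infty hdiv (hx₁.trans_le hxc)
  refine ⟨v + u', hv.add_of_le_infty ((hu'.le.trans hux).trans hxv.le),
    CuSemigroup.le_add_left' _ _, le_trans ?_ hle,
    hxv.le.trans (infty_mono (CuSemigroup.le_add_right' _ _))⟩
  rw [add_comm]
  gcongr

lemma StronglySoft.exists_slack (hdiv : TwoOmegaDivisible S) {e w q : S} (he : StronglySoft e)
    (hw : WayBelow w e) (hq : WayBelow q (infty e)) :
    ∃ E t, StronglySoft E ∧ WayBelow w E ∧ WayBelow q (infty E) ∧ WayBelow (E + t) e ∧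
      E ≤ infty t := by
  obtain ⟨p, hp, hqp⟩ := hq.exists_infty
  obtain ⟨m, hwm, hpm, hm⟩ := hw.exists_common hp
  obtain ⟨E, hE, hmE, hEe⟩ := he.exists_between hdiv hm
  obtain ⟨t, ht, hEt⟩ := he E hEe
  exact ⟨E, t, hE, hwm.trans hmE, hqp.trans_le (infty_mono (hpm.trans hmE).le), ht, hEt.le⟩

/-- Two strongly soft elements below `x` that generate each other's ideals up to way-below
are, up to way-below, dominated by a strongly soft element below `x`. -/
lemma StronglySoft.exists_upper_bound (hsep : LeftSoftSeparative S) (hdiv : TwoOmegaDivisible S)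
    (hO5 : SatisfiesO5 S) (hO6 : SatisfiesO6 S) (hO7 : SatisfiesO7 S) {e₁ e₂ w₁ w₂ u₁ u₂ x : S}
    (he₁ : StronglySoft e₁) (he₂ : StronglySoft e₂) (hx₁ : e₁ ≤ x) (hx₂ : e₂ ≤ x)
    (hw₁ : WayBelow w₁ e₁) (hw₂ : WayBelow w₂ e₂) (hw₁₂ : WayBelow w₁ (infty e₂))
    (hw₂₁ : WayBelow w₂ (infty e₁)) (hu₁ : WayBelow u₁ w₁) (hu₂ : WayBelow u₂ w₂) :
    ∃ y, StronglySoft y ∧ y ≤ x ∧ WayBelow u₁ y ∧ WayBelow u₂ y := by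
  obtain ⟨E₁, t₁, hE₁, hwE₁, hqE₁, hEt₁, ht₁⟩ := he₁.exists_slack hdiv hw₁
    ((hw₁.trans_le (le_infty e₁)).add_infty hw₂₁)
  obtain ⟨E₂, t₂, hE₂, hwE₂, hqE₂, hEt₂, ht₂⟩ := he₂.exists_slack hdiv hw₂
    (hw₁₂.add_infty (hw₂.trans_le (le_infty e₂)))
  obtain ⟨p₁, hup₁, hpw₁⟩ := hu₁.exists_between
  obtain ⟨p₂, hup₂, hpw₂⟩ := hu₂.exists_between
  obtain ⟨q, hpq, hqw⟩ := (CuSemigroup.O3 hpw₁ hpw₂).exists_between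
  obtain ⟨q', hpq', hqq'⟩ := hpq.exists_between
  obtain ⟨r₁, hr₁w, hr₁t, hqr₁⟩ := exists_le_le_infty hdiv hO6 hO7 hqw
    (hqE₁.le.trans (infty_le_infty ht₁))
  obtain ⟨r₁', hr₁', hqr₁'⟩ := (hqq'.trans_le hqr₁).exists_infty
  obtain ⟨r, hrr₁, hrt₂, hr₁r⟩ := exists_le_le_infty hdiv hO6 hO7 hr₁'
    (hr₁w.trans (hqE₂.le.trans (infty_le_infty ht₂)))
  have hrt₁ : r ≤ t₁ := hrr₁.trans hr₁t
  have hrE₁ : WayBelow r (infty E₁) := .of_le (hrr₁.trans hr₁w) hqE₁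
  have hrE₂ : WayBelow r (infty E₂) := .of_le (hrr₁.trans hr₁w) hqE₂
  obtain ⟨r', hr', hpr'⟩ :=
    (hpq'.trans_le (hqr₁'.le.trans (infty_le_infty hr₁r))).exists_infty
  obtain ⟨y', hy', hry'⟩ := hrE₁.exists_infty
  have hrE : r + E₁ ≤ x := by
    rw [add_comm]
    exact (add_le_add_right hrt₁ E₁).trans (hEt₁.le.trans hx₁)
  obtain ⟨c, hyc, hle, hge⟩ := hO5 r' r y' E₁ x hr' hy' hrE
  rw [add_comm] at hge
  have hrc : WayBelow r (infty c) := hry'.trans_le (infty_mono hyc.le)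
  have hE₁c : WayBelow E₁ c := hsep E₁ c r hE₁
    (.of_le (add_le_add_right hrt₁ E₁) (hEt₁.trans_le (hx₁.trans hge))) hrE₁ hrc
  have hE₂c : WayBelow E₂ c := hsep E₂ c r hE₂
    (.of_le (add_le_add_right hrt₂ E₂) (hEt₂.trans_le (hx₂.trans hge))) hrE₂ hrc
  obtain ⟨z, huz₁, huz₂, hzc, hzp⟩ := hO7 u₁ p₁ u₂ p₂ c hup₁ ((hpw₁.trans hwE₁).trans hE₁c).le
    hup₂ ((hpw₂.trans hwE₂).trans hE₂c).le
  obtain ⟨v, hv, hvr, hpv⟩ := exists_stronglySoft_wayBelow_infty hdiv hpr'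
  exact ⟨v + z, hv.add_of_le_infty (hzp.trans hpv.le), (add_le_add hvr hzc).trans hle,
    huz₁.trans_le (CuSemigroup.le_add_left' _ _), huz₂.trans_le (CuSemigroup.le_add_left' _ _)⟩

lemma directedOn_Lset (hsep : LeftSoftSeparative S) (hdiv : TwoOmegaDivisible S)
    (hO5 : SatisfiesO5 S) (hO6 : SatisfiesO6 S) (hO7 : SatisfiesO7 S) (x : S) :
    DirectedOn (· ≤ ·) (Lset x) := by
  rintro a₁ ⟨u₁, hu₁, ha₁, hux₁⟩ a₂ ⟨u₂, hu₂, ha₂, hux₂⟩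
  obtain ⟨x₁, h₁, h₂, hx₁⟩ := hux₁.exists_common hux₂
  obtain ⟨x₂, hx₁₂, hx₂⟩ := hx₁.exists_between
  obtain ⟨b₁, hab₁, hbu₁⟩ := ha₁.exists_between
  obtain ⟨b₂, hab₂, hbu₂⟩ := ha₂.exists_between
  obtain ⟨w₁, haw₁, hwb₁⟩ := hab₁.exists_between
  obtain ⟨w₂, haw₂, hwb₂⟩ := hab₂.exists_between
  obtain ⟨e₁, he₁, hbe₁, hex₁, hxe₁⟩ := hu₁.exists_ge_full hdiv hO5 hbu₁ h₁.le hx₁₂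
  obtain ⟨e₂, he₂, hbe₂, hex₂, hxe₂⟩ := hu₂.exists_ge_full hdiv hO5 hbu₂ h₂.le hx₁₂
  obtain ⟨y, hy, hyx, hay₁, hay₂⟩ := StronglySoft.exists_upper_bound hsep hdiv hO5 hO6 hO7
    he₁ he₂ hex₁ hex₂ (hwb₁.trans_le hbe₁) (hwb₂.trans_le hbe₂)
    (((hwb₁.trans hbu₁).trans h₁).trans_le hxe₂) (((hwb₂.trans hbu₂).trans h₂).trans_le hxe₁)
    haw₁ haw₂
  obtain ⟨m, ham₁, ham₂, hm⟩ := hay₁.exists_common hay₂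
  exact ⟨m, ⟨y, hy, hm, .of_le hyx hx₂⟩, ham₁.le, ham₂.le⟩

lemma zero_mem_Lset (x : S) : (0 : S) ∈ Lset x :=
  ⟨0, stronglySoft_zero, .zero 0, .zero x⟩

lemma exists_seq_isLUB (hcb : CountablyBased S) {L : Set S} (hne : L.Nonempty)
    (hdir : DirectedOn (· ≤ ·) L) (hL : ∀ a ∈ L, ∃ b ∈ L, WayBelow a b)
    (hlow : ∀ a ∈ L, ∀ b, b ≤ a → b ∈ L) {s : S} (hs : IsLUB L s) :
    ∃ g : ℕ → S, Monotone g ∧ (∀ n, g n ∈ L) ∧ IsLUB (Set.range g) s := by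
  obtain ⟨D, hD, hbase⟩ := hcb
  have hcof : ∀ a ∈ L, ∃ d ∈ D ∩ L, a ≤ d := by
    intro a ha
    obtain ⟨b, hb, hab⟩ := hL a ha
    obtain ⟨z, hz, hzD, hlub⟩ := hbase b
    obtain ⟨m, hm⟩ := hab z hz b hlub le_rfl
    exact ⟨z m, ⟨hzD m, hlow b hb _ (hlub.1 ⟨m, rfl⟩)⟩, hm⟩
  obtain ⟨a₀, ha₀⟩ := hne
  obtain ⟨d₀, hd₀, -⟩ := hcof a₀ ha₀
  have : Countable ↥(D ∩ L) := (hD.mono Set.inter_subset_left).to_subtype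
  let _ : Encodable ↥(D ∩ L) := Encodable.ofCountable _
  let _ : Inhabited ↥(D ∩ L) := ⟨⟨d₀, hd₀⟩⟩
  have hdir' : Directed (· ≤ ·) (Subtype.val : ↥(D ∩ L) → S) := by
    rintro ⟨a, ha⟩ ⟨b, hb⟩
    obtain ⟨c, hc, hac, hbc⟩ := hdir a ha.2 b hb.2
    obtain ⟨d, hd, hcd⟩ := hcof c hc
    exact ⟨⟨d, hd⟩, hac.trans hcd, hbc.trans hcd⟩
  refine ⟨fun n => (hdir'.sequence _ n : S), hdir'.sequence_mono,
    fun n => (hdir'.sequence _ n).2.2, ?_, fun b hb => hs.2 fun a ha => ?_⟩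
  · rintro _ ⟨n, rfl⟩
    exact hs.1 (hdir'.sequence _ n).2.2
  · obtain ⟨d, hd, had⟩ := hcof a ha
    exact had.trans ((hdir'.rel_sequence ⟨d, hd⟩).trans (hb ⟨_, rfl⟩))

lemma Lset_of_le {x a b : S} (ha : a ∈ Lset x) (hba : b ≤ a) : b ∈ Lset x := by
  obtain ⟨u, hu, hau, hux⟩ := ha
  exact ⟨u, hu, .of_le hba hau, hux⟩

lemma exists_mem_Lset_wayBelow {x a : S} (ha : a ∈ Lset x) : ∃ b ∈ Lset x, WayBelow a b := by
  obtain ⟨u, hu, hau, hux⟩ := ha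
  obtain ⟨b, hab, hb⟩ := hau.exists_between
  exact ⟨b, ⟨u, hu, hb, hux⟩, hab⟩

lemma Lset_mono {x y : S} (h : x ≤ y) : Lset x ⊆ Lset y := by
  rintro a ⟨u, hu, hau, hux⟩
  exact ⟨u, hu, hau, hux.trans_le h⟩

lemma add_mem_Lset {x y a b : S} (ha : a ∈ Lset x) (hb : b ∈ Lset y) : a + b ∈ Lset (x + y) := by
  obtain ⟨u, hu, hau, hux⟩ := ha
  obtain ⟨v, hv, hbv, hvy⟩ := hb
  exact ⟨u + v, hu.add hv, CuSemigroup.O3 hau hbv, CuSemigroup.O3 hux hvy⟩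

end Directed

section SupLset

variable [CuSemigroup S] {x s v w : S}

lemma StronglySoft.le_of_isLUB_Lset (hv : StronglySoft v) (hvx : WayBelow v x)
    (hs : IsLUB (Lset x) s) : v ≤ s :=
  le_of_forall_wayBelow_le fun _ hv' => hs.1 ⟨v, hv, hv', hvx⟩

lemma isLUB_Lset_le (hs : IsLUB (Lset x) s) : s ≤ x :=
  hs.2 fun _ ⟨_, _, hau, hux⟩ => (hau.trans hux).le

lemma le_infty_of_isLUB_Lset (hdiv : TwoOmegaDivisible S) (hs : IsLUB (Lset x) s) :
    x ≤ infty s := by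
  refine le_of_forall_wayBelow_le fun x' hx' => ?_
  obtain ⟨m, hm, hmx⟩ := hx'.exists_between
  obtain ⟨v, hv, hvm, hle⟩ := exists_stronglySoft_le hdiv hm
  exact hle.trans (infty_mono (hv.le_of_isLUB_Lset (.of_le hvm hmx) hs))

lemma stronglySoft_of_isLUB_Lset (hs : IsLUB (Lset x) s) {g : ℕ → S} (hg : Monotone g)
    (hgL : ∀ n, g n ∈ Lset x) (hgs : IsLUB (Set.range g) s) : StronglySoft s := by
  refine .of_le fun x' hx' => ?_
  obtain ⟨n, hn⟩ := hx' g hg s hgs le_rfl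
  obtain ⟨u, hu, hgu, hux⟩ := hgL n
  obtain ⟨t, ht, hgt⟩ := hu _ hgu
  exact ⟨t, (add_le_add_left hn t).trans (ht.le.trans (hu.le_of_isLUB_Lset hux hs)),
    hn.trans hgt.le⟩

/-- A strongly soft `w` absorbs the difference between `x` and the supremum of `Lset x`, provided
`x` lies in the ideal generated by `w`. -/
lemma StronglySoft.add_le_add_of_isLUB_Lset (hdiv : TwoOmegaDivisible S) (hO5 : SatisfiesO5 S)
    (hO6 : SatisfiesO6 S) (hO7 : SatisfiesO7 S) (hw : StronglySoft w) (hx : x ≤ infty w)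
    (hs : IsLUB (Lset x) s) : x + w ≤ s + w := by
  refine add_le_of_forall_wayBelow_le fun x₁ w₁ hx₁ hw₁ => ?_
  obtain ⟨x₂, hx₁₂, hx₂⟩ := hx₁.exists_between
  obtain ⟨x₃, hx₂₃, hx₃⟩ := hx₂.exists_between
  obtain ⟨x₄, hx₃₄, hx₄⟩ := hx₃.exists_between
  obtain ⟨p, hp, hxp⟩ := (hx₄.trans_le hx).exists_infty
  obtain ⟨w', hw₁', hpw', hw'⟩ := hw₁.exists_common hp
  obtain ⟨t, ht, hwt⟩ := hw w' hw'
  have hxt : x₄ ≤ infty t := hxp.le.trans (infty_le_infty (hpw'.le.trans hwt.le))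
  obtain ⟨r, hrx, hrt, hxr⟩ := exists_le_le_infty hdiv hO6 hO7 hx₃₄ hxt
  obtain ⟨r', hr', hxr'⟩ := (hx₂₃.trans_le hxr).exists_infty
  obtain ⟨v, hv, hvr, hxv⟩ := exists_stronglySoft_wayBelow_infty hdiv hxr'
  obtain ⟨c, -, hle, hge⟩ := hO5 r' r 0 0 x₄ hr' (.zero 0) (by simpa using hrx)
  obtain ⟨a, b, -, har, hbx, hbc, hab⟩ := hO6 x₁ x₂ r c hx₁₂ ((hx₂₃.trans hx₃₄).trans_le hge)
  have hys : v + b ≤ s := (hv.add_of_le_infty (hbx.trans hxv.le)).le_of_isLUB_Lset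
    (.of_le ((add_le_add hvr hbc).trans hle) hx₄) hs
  calc x₁ + w₁ ≤ (t + s) + w' := by
        refine add_le_add (hab.trans (add_le_add (har.trans hrt) ?_)) hw₁'.le
        exact (CuSemigroup.le_add_left' _ _).trans hys
    _ = s + (w' + t) := by abel
    _ ≤ s + w := add_le_add_right ht.le s

end SupLset

/-- In a countably based, left-soft separative, (2,ω)-divisible
Cu-semigroup satisfying (O5)-(O7), the map `σ` (sending `x` to the supremum of
`L_x`) preserves order, suprema of increasing sequences, is superadditive, and
satisfies `2σ(x+y) = σ(x+y) + (σ(x)+σ(y)) = 2(σ(x)+σ(y))`. -/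
theorem sigma_genCuMorphism_properties {S : Type*} [CuSemigroup S]
    (hcb : CountablyBased S) (hsep : LeftSoftSeparative S)
    (hdiv : TwoOmegaDivisible S)
    (hO5 : SatisfiesO5 S) (hO6 : SatisfiesO6 S) (hO7 : SatisfiesO7 S)
    (sigma : S → S) (hsigma : ∀ x : S, IsLUB (Lset x) (sigma x)) :
    (∀ x y : S, x ≤ y → sigma x ≤ sigma y) ∧
    (∀ z : ℕ → S, Monotone z → ∀ s : S, IsLUB (Set.range z) s →
      IsLUB (Set.range fun n => sigma (z n)) (sigma s)) ∧
    (∀ x y : S, sigma x + sigma y ≤ sigma (x + y)) ∧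
    (∀ x y : S, 2 • sigma (x + y) = sigma (x + y) + (sigma x + sigma y) ∧
      sigma (x + y) + (sigma x + sigma y) = 2 • (sigma x + sigma y)) := by
  have hmono : ∀ x y : S, x ≤ y → sigma x ≤ sigma y := fun x y h =>
    (hsigma x).mono (hsigma y) (Lset_mono h)
  have hseq : ∀ x : S, ∃ g : ℕ → S, Monotone g ∧ (∀ n, g n ∈ Lset x) ∧
      IsLUB (Set.range g) (sigma x) := fun x =>
    exists_seq_isLUB hcb ⟨0, zero_mem_Lset x⟩ (directedOn_Lset hsep hdiv hO5 hO6 hO7 x)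
      (fun _ => exists_mem_Lset_wayBelow) (fun _ ha _ => Lset_of_le ha) (hsigma x)
  have hsoft : ∀ x : S, StronglySoft (sigma x) := fun x => by
    obtain ⟨g, hg, hgL, hgs⟩ := hseq x
    exact stronglySoft_of_isLUB_Lset (hsigma x) hg hgL hgs
  have hsuper : ∀ x y : S, sigma x + sigma y ≤ sigma (x + y) := fun x y => by
    obtain ⟨f, hf, hfL, hfs⟩ := hseq x
    obtain ⟨g, hg, hgL, hgs⟩ := hseq y
    refine (CuSemigroup.O4 f g hf hg _ _ hfs hgs).2 ?_
    rintro _ ⟨n, rfl⟩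
    exact (hsigma (x + y)).1 (add_mem_Lset (hfL n) (hgL n))
  have habsorb : ∀ x y w : S, StronglySoft w → sigma x + sigma y ≤ w →
      sigma (x + y) + w ≤ w + (sigma x + sigma y) := fun x y w hw hle => by
    have hx : x ≤ infty w := (le_infty_of_isLUB_Lset hdiv (hsigma x)).trans
      (infty_mono ((CuSemigroup.le_add_right' _ _).trans hle))
    have hy : y ≤ infty w := (le_infty_of_isLUB_Lset hdiv (hsigma y)).trans
      (infty_mono ((CuSemigroup.le_add_left' _ _).trans hle))
    calc sigma (x + y) + w ≤ (x + y) + w := add_le_add_left (isLUB_Lset_le (hsigma _)) w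
      _ = x + (y + w) := add_assoc _ _ _
      _ ≤ x + (sigma y + w) :=
        add_le_add_right (hw.add_le_add_of_isLUB_Lset hdiv hO5 hO6 hO7 hy (hsigma y)) x
      _ = sigma y + (x + w) := by abel
      _ ≤ sigma y + (sigma x + w) :=
        add_le_add_right (hw.add_le_add_of_isLUB_Lset hdiv hO5 hO6 hO7 hx (hsigma x)) _
      _ = w + (sigma x + sigma y) := by abel
  refine ⟨hmono, fun z hz s hs => ⟨?_, fun b hb => (hsigma s).2 ?_⟩, hsuper, fun x y => ⟨?_, ?_⟩⟩
  · rintro _ ⟨n, rfl⟩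
    exact hmono _ _ (hs.1 ⟨n, rfl⟩)
  · rintro a ⟨u, hu, hau, hus⟩
    obtain ⟨m, hum, hms⟩ := hus.exists_between
    obtain ⟨n, hn⟩ := hms z hz s hs le_rfl
    exact ((hsigma (z n)).1 ⟨u, hu, hau, hum.trans_le hn⟩).trans (hb ⟨n, rfl⟩)
  · rw [two_nsmul]
    exact le_antisymm (habsorb x y _ (hsoft _) (hsuper x y)) (add_le_add_right (hsuper x y) _)
  · rw [two_nsmul]
    exact le_antisymm (habsorb x y _ ((hsoft x).add (hsoft y)) le_rfl)
      (add_le_add_left (hsuper x y) _)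
end

section
/- Let S and T be Cu-semigroups, let φ: S → T be a generalized Cu-morphism that is also an order embedding (x ≤ y iff φ(x) ≤ φ(y)), and let e ∈ S be a full element such that φ(e) is full in T. Then rc(S,e) ≤ rc(T,φ(e)). -/
open Set

variable {S : Type*}

/-- The pullback of a functional along a generalized Cu-morphism. -/
def CuFunctional.comp {S T : Type*} [CuSemigroup S] [CuSemigroup T] (mu : CuFunctional T)
    (phi : S → T) (hzero : phi 0 = 0)
    (hadd : ∀ x y : S, phi (x + y) = phi x + phi y)
    (hmono : ∀ x y : S, x ≤ y → phi x ≤ phi y)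
    (hsup : ∀ z : ℕ → S, Monotone z → ∀ s : S, IsLUB (Set.range z) s →
      IsLUB (Set.range fun n => phi (z n)) (phi s)) : CuFunctional S where
  toFun x := mu.toFun (phi x)
  map_zero := by rw [hzero, mu.map_zero]
  map_add x y := by rw [hadd, mu.map_add]
  mono x y h := mu.mono _ _ (hmono x y h)
  map_sup z hz s hs :=
    mu.map_sup (fun n => phi (z n)) (fun _ _ h => hmono _ _ (hz h)) _ (hsup z hz s hs)

/-- If `φ : S → T` is a generalized Cu-morphism and an order
embedding, `e ∈ S` is full and `φ(e)` is full in `T`, then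
`rc(S,e) ≤ rc(T,φ(e))`. -/
theorem rc_le_of_genCuMorphism {S T : Type*} [CuSemigroup S] [CuSemigroup T]
    (phi : S → T) (hzero : phi 0 = 0)
    (hadd : ∀ x y : S, phi (x + y) = phi x + phi y)
    (hmono : ∀ x y : S, x ≤ y → phi x ≤ phi y)
    (hsup : ∀ z : ℕ → S, Monotone z → ∀ s : S, IsLUB (Set.range z) s →
      IsLUB (Set.range fun n => phi (z n)) (phi s))
    (hemb : ∀ x y : S, x ≤ y ↔ phi x ≤ phi y)
    (e : S) (he : IsFull e) (he' : IsFull (phi e)) :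
    rc S e ≤ rc T (phi e) := by
  refine le_iInf₂ fun r hr => iInf₂_le r ⟨hr.1, fun x y h => (hemb x y).2 ?_⟩
  exact hr.2 _ _ fun mu => h (mu.comp phi hzero hadd hmono hsup)
end
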